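/- arXiv:1301.7159 — 2 statements merged into one kernel-verified Lean document; each statement's English description precedes it below -/
import Mathlib

section
/- Let ν, a, s ∈ ℝ with 0 < |ν| ≤ 1 and s ≠ 0, and let r ∈ ℤ. Suppose that every solution x of the class-D equation with parameters (ν, a, s) satisfies x(2π) = x(0) + 2πr (i.e., (a,s) is a constriction with rotation number r). Then a = r. -/
open Real

/-- A solution of the class-D equation `ẋ = ν sin x + a + s sin t`. -/
def IsClassDSolution (ν a s : ℝ) (x : ℝ → ℝ) : Prop :=
  ∀ t : ℝ, HasDerivAt x (ν * Real.sin (x t) + a + s * Real.sin t) t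

open Complex (I)
open Filter Topology

/-- The class-D equation has a global solution through every initial value. -/
theorem IsClassDSolution.exists_initial (ν a s x₀ : ℝ) :
    ∃ x : ℝ → ℝ, IsClassDSolution ν a s x ∧ x 0 = x₀ := by
  set v : ℝ → ℝ → ℝ := fun t y ↦ ν * Real.sin y + a + s * Real.sin t with hv
  have hLip : ∀ t, LipschitzWith ‖ν‖₊ (v t) := fun t ↦ by
    refine LipschitzWith.of_dist_le_mul fun y z ↦ ?_
    have h : v t y - v t z = ν * (Real.sin y - Real.sin z) := by simp only [hv]; ring
    rw [Real.dist_eq, Real.dist_eq, h, abs_mul, coe_nnnorm, Real.norm_eq_abs]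
    exact mul_le_mul_of_nonneg_left
      (by simpa [Real.dist_eq] using Real.lipschitzWith_sin.dist_le_mul y z) (abs_nonneg ν)
  have hbound : ∀ t y, ‖v t y‖ ≤ |ν| + |a| + |s| := fun t y ↦ by
    calc ‖v t y‖ ≤ |ν * Real.sin y| + |a| + |s * Real.sin t| := by
          simpa only [hv, Real.norm_eq_abs] using abs_add_three (ν * Real.sin y) a (s * Real.sin t)
      _ ≤ |ν| + |a| + |s| := by
          rw [abs_mul, abs_mul]
          gcongr
          · exact mul_le_of_le_one_right (abs_nonneg _) (Real.abs_sin_le_one y)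
          · exact mul_le_of_le_one_right (abs_nonneg _) (Real.abs_sin_le_one t)
  have hlocal : ∀ T : ℝ, ∃ γ : ℝ → ℝ, γ 0 = x₀ ∧
      ∀ t ∈ Set.Ioo (-T) T, HasDerivAt γ (v t (γ t)) t := fun T ↦ by
    rcases le_or_gt T 0 with hT | hT
    · exact ⟨fun _ ↦ x₀, rfl, fun t ht ↦ by linarith [ht.1, ht.2]⟩
    have hpl : IsPicardLindelof v (tmin := -T) (tmax := T) ⟨0, by constructor <;> linarith⟩ x₀
        ⟨(|ν| + |a| + |s|) * T, by positivity⟩ 0 ⟨|ν| + |a| + |s|, by positivity⟩ ‖ν‖₊ :=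
      { lipschitzOnWith := fun t _ ↦ (hLip t).lipschitzOnWith
        continuousOn := fun y _ ↦ by simp only [hv]; fun_prop
        norm_le := fun t _ y _ ↦ hbound t y
        mul_max_le := by
          change (|ν| + |a| + |s|) * max (T - 0) (0 - -T) ≤ (|ν| + |a| + |s|) * T - 0
          simp }
    obtain ⟨γ, h0, h⟩ := hpl.exists_eq_forall_mem_Icc_hasDerivWithinAt₀
    exact ⟨γ, h0, fun t ht ↦
      (h t (Set.Ioo_subset_Icc_self ht)).hasDerivAt (Icc_mem_nhds ht.1 ht.2)⟩
  choose γ hγ0 hγ using hlocal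
  have heq : ∀ S T : ℝ, 0 < S → S ≤ T → Set.EqOn (γ S) (γ T) (Set.Ioo (-S) S) :=
    fun S T hS hST ↦ ODE_solution_unique_of_mem_Ioo (v := v) (s := fun _ ↦ Set.univ) (t₀ := 0)
      (fun t _ ↦ (hLip t).lipschitzOnWith) ⟨by linarith, hS⟩
      (fun t ht ↦ ⟨hγ S t ht, trivial⟩)
      (fun t ht ↦ ⟨hγ T t ⟨by linarith [ht.1], by linarith [ht.2]⟩, trivial⟩)
      ((hγ0 S).trans (hγ0 T).symm)
  refine ⟨fun t ↦ γ (|t| + 1) t, fun t ↦ ?_, hγ0 _⟩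
  have hmem : ∀ u ∈ Set.Ioo (t - 1) (t + 1), γ (|u| + 1) u = γ (|t| + 2) u := fun u hu ↦ by
    have hut : |u| ≤ |t| + 1 := by
      have := abs_sub_abs_le_abs_sub u t
      have : |u - t| ≤ 1 := abs_le.2 ⟨by linarith [hu.1], by linarith [hu.2]⟩
      linarith
    exact heq _ _ (by positivity) (by linarith)
      ⟨by linarith [neg_abs_le u], by linarith [le_abs_self u]⟩
  have hder := hγ (|t| + 2) t ⟨by linarith [neg_abs_le t], by linarith [le_abs_self t]⟩
  rw [← hmem t ⟨by linarith, by linarith⟩] at hder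
  exact hder.congr_of_eventuallyEq <|
    eventually_of_mem (Ioo_mem_nhds (by linarith) (by linarith)) hmem

/-- The linear system whose projectivization is the Riccati form of the class-D equation,
satisfied by `q / p = exp (i x)`. -/
def IsLinearizedSolution (ν a s : ℝ) (p q : ℝ → ℂ) : Prop :=
  ∀ t : ℝ, HasDerivAt p (-(ν / 2) * q t) t ∧
    HasDerivAt q (I * (a + s * Real.sin t) * q t - ν / 2 * p t) t

namespace IsLinearizedSolution

variable {ν a s : ℝ} {p q p₁ q₁ p₂ q₂ : ℝ → ℂ}

theorem continuous_fst (h : IsLinearizedSolution ν a s p q) : Continuous p :=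
  continuous_iff_continuousAt.2 fun t ↦ (h t).1.continuousAt

theorem continuous_snd (h : IsLinearizedSolution ν a s p q) : Continuous q :=
  continuous_iff_continuousAt.2 fun t ↦ (h t).2.continuousAt

theorem wronskian_two_pi (h₁ : IsLinearizedSolution ν a s p₁ q₁)
    (h₂ : IsLinearizedSolution ν a s p₂ q₂) :
    p₁ (2 * π) * q₂ (2 * π) - p₂ (2 * π) * q₁ (2 * π) =
      Complex.exp (2 * π * a * I) * (p₁ 0 * q₂ 0 - p₂ 0 * q₁ 0) := by
  set F : ℝ → ℂ := fun t ↦ Complex.exp (-(I * (a * t - s * Real.cos t))) *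
    (p₁ t * q₂ t - p₂ t * q₁ t) with hF
  have hder : ∀ t, HasDerivAt F 0 t := fun t ↦ by
    have hE : HasDerivAt (fun t : ℝ ↦ Complex.exp (-(I * (a * t - s * Real.cos t))))
        (Complex.exp (-(I * (a * t - s * Real.cos t))) *
          (-(I * (a * 1 - s * ((-Real.sin t : ℝ) : ℂ))))) t :=
      (((((Complex.ofRealCLM.hasDerivAt (x := t)).const_mul (a : ℂ)).sub
        ((Real.hasDerivAt_cos t).ofReal_comp.const_mul (s : ℂ))).const_mul I).neg).cexp
    refine (hE.mul (((h₁ t).1.mul (h₂ t).2).sub ((h₂ t).1.mul (h₁ t).2))).congr_deriv ?_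
    simp only [Complex.ofReal_neg, Pi.mul_apply, Pi.sub_apply]
    ring
  have hconst : F (2 * π) = F 0 :=
    is_const_of_deriv_eq_zero (fun t ↦ (hder t).differentiableAt) (fun t ↦ (hder t).deriv) _ _
  simp only [hF, Real.cos_two_pi, Real.cos_zero] at hconst
  have hsplit : Complex.exp (-(I * (a * (0 : ℝ) - s * (1 : ℝ)))) =
      Complex.exp (2 * π * a * I) * Complex.exp (-(I * (a * (2 * π : ℝ) - s * (1 : ℝ)))) := by
    rw [← Complex.exp_add]
    congr 1
    push_cast
    ring
  rw [hsplit] at hconst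
  have hne := Complex.exp_ne_zero (-(I * (a * (2 * π : ℝ) - s * (1 : ℝ))))
  apply mul_left_cancel₀ hne
  rw [hconst]
  ring

end IsLinearizedSolution

/-- A solution of the class-D equation lifts to a solution of the linearized system. -/
theorem IsClassDSolution.exists_linearized {ν a s : ℝ} {x : ℝ → ℝ}
    (hx : IsClassDSolution ν a s x) :
    ∃ p : ℝ → ℂ, p 0 = 1 ∧
      IsLinearizedSolution ν a s p (fun t ↦ Complex.exp (x t * I) * p t) := by
  have hxc : Continuous x := continuous_iff_continuousAt.2 fun t ↦ (hx t).continuousAt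
  have hec : Continuous fun t ↦ Complex.exp (x t * I) := by fun_prop
  refine ⟨fun t ↦ Complex.exp (-(ν / 2) * ∫ u in (0 : ℝ)..t, Complex.exp (x u * I)), by simp,
    fun t ↦ ?_⟩
  have hp := ((hec.integral_hasStrictDerivAt 0 t).hasDerivAt.const_mul (-(ν / 2 : ℂ))).cexp
  have he := ((hx t).ofReal_comp.mul_const I).cexp
  refine ⟨hp.congr_deriv (by ring), (he.mul hp).congr_deriv ?_⟩
  have hsin : (Real.sin (x t) : ℂ) * Complex.exp (x t * I) * I =
      (Complex.exp (x t * I) * Complex.exp (x t * I) - 1) / 2 := by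
    have h1 : Complex.exp (-(x t) * I) * Complex.exp (x t * I) = 1 := by
      rw [← Complex.exp_add]; simp
    rw [Complex.ofReal_sin, Complex.sin]
    linear_combination (I ^ 2 / 2) * h1 + (1 - Complex.exp (x t * I) ^ 2) / 2 * Complex.I_sq
  push_cast
  push_cast at hsin
  linear_combination
    ν * Complex.exp (-(ν / 2) * ∫ u in (0 : ℝ)..t, Complex.exp (x u * I)) * hsin

/-- The Fourier coefficients on `[0, 2π]` of `f` with respect to `exp (i (b + n) t)`, up to
normalization. -/
noncomputable def twistedCoeff (b : ℝ) (f : ℝ → ℂ) (n : ℤ) : ℂ :=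
  ∫ t in (0 : ℝ)..2 * π, f t * Complex.exp (-((b + n) * t * I))

theorem continuous_mul_twist {f : ℝ → ℂ} (hf : Continuous f) (b : ℝ) (n : ℤ) :
    Continuous fun t : ℝ ↦ f t * Complex.exp (-((b + n) * t * I)) := by
  fun_prop

theorem exp_neg_twist_two_pi (b : ℝ) (n : ℤ) :
    Complex.exp (-((b + n) * (2 * π : ℝ) * I)) = Complex.exp (-(2 * π * b * I)) := by
  refine Complex.exp_eq_exp_iff_exists_int.2 ⟨-n, ?_⟩
  push_cast
  ring

theorem exists_norm_twistedCoeff_le (f : ℝ → ℂ) (b : ℝ) :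
    ∃ C, ∀ n, ‖twistedCoeff b f n‖ ≤ C := by
  refine ⟨∫ t in (0 : ℝ)..2 * π, ‖f t‖, fun n ↦ ?_⟩
  refine (intervalIntegral.norm_integral_le_integral_norm two_pi_pos.le).trans_eq ?_
  refine intervalIntegral.integral_congr fun t _ ↦ ?_
  have : -((b + n) * t * I) = ((-((b + n) * t) : ℝ) : ℂ) * I := by push_cast; ring
  simp only [norm_mul, this, Complex.norm_exp_ofReal_mul_I, mul_one]

theorem twistedCoeff_deriv {b : ℝ} {f f' : ℝ → ℂ} (hf : ∀ t, HasDerivAt f (f' t) t)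
    (hf' : Continuous f') (hper : f (2 * π) = Complex.exp (2 * π * b * I) * f 0) (n : ℤ) :
    twistedCoeff b f' n = I * (b + n) * twistedCoeff b f n := by
  have hfc : Continuous f := continuous_iff_continuousAt.2 fun t ↦ (hf t).continuousAt
  have hder : ∀ t : ℝ, HasDerivAt (fun t : ℝ ↦ f t * Complex.exp (-((b + n) * t * I)))
      (f' t * Complex.exp (-((b + n) * t * I)) -
        I * (b + n) * (f t * Complex.exp (-((b + n) * t * I)))) t := fun t ↦ by
    have hE : HasDerivAt (fun t : ℝ ↦ Complex.exp (-((b + n) * t * I)))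
        (Complex.exp (-((b + n) * t * I)) * (-((b + n) * 1 * I))) t :=
      (((Complex.ofRealCLM.hasDerivAt (x := t)).const_mul ((b : ℂ) + n)).mul_const I).neg.cexp
    exact ((hf t).mul hE).congr_deriv (by ring)
  have hint := intervalIntegral.integral_eq_sub_of_hasDerivAt (a := 0) (b := 2 * π)
    (fun t _ ↦ hder t) (((continuous_mul_twist hf' b n).sub
      ((continuous_mul_twist hfc b n).const_mul _)).intervalIntegrable _ _)
  rw [intervalIntegral.integral_sub ((continuous_mul_twist hf' b n).intervalIntegrable _ _)
    (((continuous_mul_twist hfc b n).const_mul _).intervalIntegrable _ _),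
    intervalIntegral.integral_const_mul, exp_neg_twist_two_pi, hper,
    mul_right_comm (Complex.exp _), ← Complex.exp_add, add_neg_cancel] at hint
  simp only [Complex.exp_zero, one_mul, Complex.ofReal_zero, mul_zero, zero_mul, neg_zero,
    mul_one, sub_self] at hint
  exact sub_eq_zero.1 hint

theorem twistedCoeff_add {f g : ℝ → ℂ} (hf : Continuous f) (hg : Continuous g) (b : ℝ) (n : ℤ) :
    twistedCoeff b (fun t ↦ f t + g t) n = twistedCoeff b f n + twistedCoeff b g n := by
  simp only [twistedCoeff, add_mul (f _)]
  exact intervalIntegral.integral_add ((continuous_mul_twist hf b n).intervalIntegrable _ _)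
    ((continuous_mul_twist hg b n).intervalIntegrable _ _)

theorem twistedCoeff_const_mul (f : ℝ → ℂ) (c : ℂ) (b : ℝ) (n : ℤ) :
    twistedCoeff b (fun t ↦ c * f t) n = c * twistedCoeff b f n := by
  simp only [twistedCoeff, mul_assoc]
  exact intervalIntegral.integral_const_mul _ _

theorem twistedCoeff_sin_mul {f : ℝ → ℂ} (hf : Continuous f) (b : ℝ) (n : ℤ) :
    twistedCoeff b (fun t ↦ 2 * I * (Real.sin t * f t)) n =
      twistedCoeff b f (n - 1) - twistedCoeff b f (n + 1) := by
  simp only [twistedCoeff]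
  rw [← intervalIntegral.integral_sub ((continuous_mul_twist hf b _).intervalIntegrable _ _)
    ((continuous_mul_twist hf b _).intervalIntegrable _ _)]
  refine intervalIntegral.integral_congr fun t _ ↦ ?_
  have h₁ : Complex.exp (-((b + (n - 1 : ℤ)) * t * I)) =
      Complex.exp (t * I) * Complex.exp (-((b + n) * t * I)) := by
    rw [← Complex.exp_add]; congr 1; push_cast; ring
  have h₂ : Complex.exp (-((b + (n + 1 : ℤ)) * t * I)) =
      Complex.exp (-t * I) * Complex.exp (-((b + n) * t * I)) := by
    rw [← Complex.exp_add]; congr 1; push_cast; ring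
  simp only [h₁, h₂, Complex.ofReal_sin, Complex.sin]
  linear_combination (Complex.exp (-t * I) - Complex.exp (t * I)) * f t *
    Complex.exp (-((b + n) * t * I)) * Complex.I_sq

/-- A continuous quasi-periodic function all of whose twisted coefficients vanish is zero at `0`. -/
theorem eq_zero_of_twistedCoeff_eq_zero {b : ℝ} {f : ℝ → ℂ} (hf : Continuous f)
    (hper : f (2 * π) = Complex.exp (2 * π * b * I) * f 0)
    (h : ∀ n, twistedCoeff b f n = 0) : f 0 = 0 := by
  have : Fact (0 < 2 * π) := ⟨two_pi_pos⟩
  set g : ℝ → ℂ := fun t ↦ f t * Complex.exp (-((b + (0 : ℤ)) * t * I)) with hg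
  have hgper : g 0 = g (2 * π) := by
    simp only [hg]
    rw [exp_neg_twist_two_pi, hper, mul_right_comm (Complex.exp _), ← Complex.exp_add]
    simp
  have hgc : Continuous (AddCircle.liftIco (2 * π) 0 g) :=
    AddCircle.liftIco_zero_continuous hgper (continuous_mul_twist hf b 0).continuousOn
  have hcoeff : ∀ n, fourierCoeff (AddCircle.liftIco (2 * π) 0 g) n = 0 := fun n ↦ by
    rw [fourierCoeff_eq_intervalIntegral _ _ 0, zero_add]
    have : ∫ t in (0 : ℝ)..2 * π, fourier (-n) (t : AddCircle (2 * π)) •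
        AddCircle.liftIco (2 * π) 0 g t = twistedCoeff b f n := by
      refine intervalIntegral.integral_congr_Ioo_of_le two_pi_pos.le fun t ht ↦ ?_
      have hπ : (π : ℂ) ≠ 0 := by exact_mod_cast pi_ne_zero
      simp only [AddCircle.liftIco_zero_coe_apply (Set.Ioo_subset_Ico_self ht), fourier_coe_apply,
        smul_eq_mul, hg]
      rw [mul_left_comm, ← Complex.exp_add]
      congr 2
      push_cast
      field_simp
      ring
    rw [this, h n, smul_zero]
  have hsum := has_pointwise_sum_fourier_series_of_summable
    (f := ⟨AddCircle.liftIco (2 * π) 0 g, hgc⟩) (by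
      simpa only [ContinuousMap.coe_mk, funext hcoeff] using summable_zero)
    ((0 : ℝ) : AddCircle (2 * π))
  simp only [ContinuousMap.coe_mk, hcoeff, zero_smul] at hsum
  have h0 := hsum.unique hasSum_zero
  rw [AddCircle.liftIco_zero_coe_apply ⟨le_rfl, two_pi_pos⟩] at h0
  simpa [hg] using h0

/-- Two solutions, decaying at `+∞`, of a common three-term recurrence with unit outer
coefficients are linearly dependent. -/
theorem exists_dependent_of_recurrence {α u v : ℤ → ℂ}
    (hu : ∀ n, u (n + 1) = u (n - 1) + α n * u n)
    (hv : ∀ n, v (n + 1) = v (n - 1) + α n * v n)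
    (hu0 : Tendsto (fun n : ℕ ↦ u n) atTop (𝓝 0))
    (hv0 : Tendsto (fun n : ℕ ↦ v n) atTop (𝓝 0)) :
    ∃ c d : ℂ, (c ≠ 0 ∨ d ≠ 0) ∧ ∀ n, c * u n + d * v n = 0 := by
  have hcas : ∀ n : ℕ, ‖u (n + 1) * v n - u n * v (n + 1)‖ = ‖u 1 * v 0 - u 0 * v 1‖ := fun n ↦ by
    induction n with
    | zero => simp
    | succ n ih =>
      rw [← ih, ← norm_neg]
      have h₁ := hu (n + 1)
      have h₂ := hv (n + 1)
      rw [add_sub_cancel_right] at h₁ h₂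
      push_cast
      rw [h₁, h₂]
      congr 1
      ring
  have hlim : Tendsto (fun n : ℕ ↦ ‖u (n + 1) * v n - u n * v (n + 1)‖) atTop (𝓝 0) := by
    have hu1 := hu0.comp (tendsto_add_atTop_nat 1)
    have hv1 := hv0.comp (tendsto_add_atTop_nat 1)
    simpa [Function.comp_def] using ((hu1.mul hv0).sub (hu0.mul hv1)).norm
  simp only [hcas] at hlim
  have hzero : u 1 * v 0 - u 0 * v 1 = 0 :=
    norm_eq_zero.1 (tendsto_nhds_unique tendsto_const_nhds hlim)
  obtain ⟨c, d, hcd, h0, h1⟩ : ∃ c d : ℂ, (c ≠ 0 ∨ d ≠ 0) ∧ c * u 0 + d * v 0 = 0 ∧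
      c * u 1 + d * v 1 = 0 := by
    by_cases h : u 0 = 0 ∧ v 0 = 0
    · by_cases h' : u 1 = 0 ∧ v 1 = 0
      · exact ⟨1, 0, by simp, by simp [h.1], by simp [h'.1]⟩
      · exact ⟨v 1, -u 1, by simpa [or_comm, imp_iff_not_or] using h', by simp [h.1, h.2], by ring⟩
    · refine ⟨v 0, -u 0, by simpa [or_comm, imp_iff_not_or] using h, by ring, ?_⟩
      linear_combination hzero
  have key : ∀ n : ℤ, c * u n + d * v n = 0 ∧ c * u (n + 1) + d * v (n + 1) = 0 := fun n ↦ by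
    induction n using Int.induction_on with
    | zero => exact ⟨h0, by simpa using h1⟩
    | succ n ih =>
      refine ⟨ih.2, ?_⟩
      have h₁ := hu (n + 1)
      have h₂ := hv (n + 1)
      rw [add_sub_cancel_right] at h₁ h₂
      rw [h₁, h₂]
      linear_combination ih.1 + α (n + 1) * ih.2
    | pred n ih =>
      rw [sub_add_cancel]
      refine ⟨?_, ih.1⟩
      linear_combination ih.2 - c * hu (-n) - d * hv (-n) - α (-n) * ih.1
  exact ⟨c, d, hcd, fun n ↦ (key n).1⟩

namespace IsLinearizedSolution

variable {ν a s b : ℝ} {p q p₁ q₁ p₂ q₂ : ℝ → ℂ}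

theorem twistedCoeff_fst (h : IsLinearizedSolution ν a s p q)
    (hp : p (2 * π) = Complex.exp (2 * π * b * I) * p 0) (n : ℤ) :
    I * (b + n) * twistedCoeff b p n = -(ν / 2) * twistedCoeff b q n := by
  rw [← twistedCoeff_deriv (fun t ↦ (h t).1) (h.continuous_snd.const_mul _) hp,
    twistedCoeff_const_mul]

theorem twistedCoeff_snd (h : IsLinearizedSolution ν a s p q)
    (hq : q (2 * π) = Complex.exp (2 * π * b * I) * q 0) (n : ℤ) :
    I * (b + n) * twistedCoeff b q n = I * a * twistedCoeff b q n +
      s / 2 * (twistedCoeff b q (n - 1) - twistedCoeff b q (n + 1)) -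
      ν / 2 * twistedCoeff b p n := by
  have hpc := h.continuous_fst
  have hqc := h.continuous_snd
  rw [← twistedCoeff_deriv (fun t ↦ (h t).2) (by fun_prop) hq, ← twistedCoeff_sin_mul hqc]
  have : (fun t ↦ I * (a + s * Real.sin t) * q t - ν / 2 * p t) = fun t ↦
      (I * a * q t + s / 2 * (2 * I * (Real.sin t * q t))) + -(ν / 2) * p t := by
    funext t; ring
  rw [this, twistedCoeff_add (by fun_prop) (by fun_prop), twistedCoeff_add (by fun_prop)
    (by fun_prop), twistedCoeff_const_mul,
    twistedCoeff_const_mul (fun t ↦ 2 * I * (Real.sin t * q t)), twistedCoeff_const_mul p]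
  ring

theorem tendsto_twistedCoeff_snd (h : IsLinearizedSolution ν a s p q)
    (hq : q (2 * π) = Complex.exp (2 * π * b * I) * q 0) :
    Tendsto (fun n : ℕ ↦ twistedCoeff b q n) atTop (𝓝 0) := by
  obtain ⟨C, hC⟩ :=
    exists_norm_twistedCoeff_le (fun t ↦ I * (a + s * Real.sin t) * q t - ν / 2 * p t) b
  have hlim : Tendsto (fun n : ℕ ↦ C / |b + n|) atTop (𝓝 0) :=
    tendsto_const_nhds.div_atTop <| tendsto_abs_atTop_atTop.comp <|
      tendsto_atTop_add_const_left _ _ tendsto_natCast_atTop_atTop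
  refine squeeze_zero_norm' ?_ hlim
  filter_upwards [(tendsto_atTop_add_const_left _ b
    (tendsto_natCast_atTop_atTop (R := ℝ))).eventually_gt_atTop 0] with n hn
  rw [le_div_iff₀ (abs_pos.2 hn.ne')]
  have hle := hC n
  rw [twistedCoeff_deriv (fun t ↦ (h t).2)
    (by have := h.continuous_fst; have := h.continuous_snd; fun_prop) hq] at hle
  have hnorm : ‖(b : ℂ) + (n : ℤ)‖ = |b + n| := by
    rw [← Real.norm_eq_abs, ← Complex.norm_real]; push_cast; rfl
  rw [norm_mul, norm_mul, Complex.norm_I, one_mul, hnorm] at hle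
  rwa [mul_comm]

/-- Two solutions with a common multiplier `exp (2πib)`, `b ∉ ℤ`, are linearly dependent. -/
theorem wronskian_eq_zero (hs : s ≠ 0) (hb : ∀ n : ℤ, (b : ℂ) + n ≠ 0)
    (h₁ : IsLinearizedSolution ν a s p₁ q₁) (h₂ : IsLinearizedSolution ν a s p₂ q₂)
    (hp₁ : p₁ (2 * π) = Complex.exp (2 * π * b * I) * p₁ 0)
    (hq₁ : q₁ (2 * π) = Complex.exp (2 * π * b * I) * q₁ 0)
    (hp₂ : p₂ (2 * π) = Complex.exp (2 * π * b * I) * p₂ 0)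
    (hq₂ : q₂ (2 * π) = Complex.exp (2 * π * b * I) * q₂ 0) :
    p₁ 0 * q₂ 0 - p₂ 0 * q₁ 0 = 0 := by
  have hsC : (s : ℂ) ≠ 0 := by exact_mod_cast hs
  have hrec : ∀ {p q : ℝ → ℂ}, IsLinearizedSolution ν a s p q →
      p (2 * π) = Complex.exp (2 * π * b * I) * p 0 →
      q (2 * π) = Complex.exp (2 * π * b * I) * q 0 → ∀ n : ℤ,
      twistedCoeff b q (n + 1) = twistedCoeff b q (n - 1) +
        2 / s * (I * a - I * (b + n) + ν / 2 * (ν / 2) / (I * (b + n))) * twistedCoeff b q n := by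
    intro p q h hp hq n
    have hk : I * ((b : ℂ) + n) ≠ 0 := mul_ne_zero Complex.I_ne_zero (hb n)
    have hP : twistedCoeff b p n = -(ν / 2) * twistedCoeff b q n / (I * (b + n)) := by
      rw [eq_div_iff hk, mul_comm, h.twistedCoeff_fst hp]
    have hQ := h.twistedCoeff_snd hq n
    rw [hP] at hQ
    generalize I * ((b : ℂ) + n) = k at *
    field_simp at hQ ⊢
    linear_combination hQ
  obtain ⟨c, d, hcd, hdep⟩ := exists_dependent_of_recurrence (hrec h₁ hp₁ hq₁) (hrec h₂ hp₂ hq₂)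
    (h₁.tendsto_twistedCoeff_snd hq₁) (h₂.tendsto_twistedCoeff_snd hq₂)
  have hpc₁ := h₁.continuous_fst
  have hpc₂ := h₂.continuous_fst
  have hqc₁ := h₁.continuous_snd
  have hqc₂ := h₂.continuous_snd
  have hq : c * q₁ 0 + d * q₂ 0 = 0 := by
    refine eq_zero_of_twistedCoeff_eq_zero (b := b) (f := fun t ↦ c * q₁ t + d * q₂ t)
      (by fun_prop) (by simp only [hq₁, hq₂]; ring) fun n ↦ ?_
    rw [twistedCoeff_add (by fun_prop) (by fun_prop), twistedCoeff_const_mul,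
      twistedCoeff_const_mul, hdep n]
  have hp : c * p₁ 0 + d * p₂ 0 = 0 := by
    refine eq_zero_of_twistedCoeff_eq_zero (b := b) (f := fun t ↦ c * p₁ t + d * p₂ t)
      (by fun_prop) (by simp only [hp₁, hp₂]; ring) fun n ↦ ?_
    rw [twistedCoeff_add (by fun_prop) (by fun_prop), twistedCoeff_const_mul,
      twistedCoeff_const_mul]
    apply mul_left_cancel₀ (mul_ne_zero Complex.I_ne_zero (hb n))
    linear_combination c * h₁.twistedCoeff_fst hp₁ n + d * h₂.twistedCoeff_fst hp₂ n -
      (ν / 2) * hdep n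
  rcases hcd with hc | hd
  · apply mul_left_cancel₀ hc
    linear_combination q₂ 0 * hp - p₂ 0 * hq
  · apply mul_left_cancel₀ hd
    linear_combination p₁ 0 * hq - q₁ 0 * hp

end IsLinearizedSolution

/-- The abscissa of a constriction is an integer. -/
theorem exists_int_eq_of_constriction {ν a s : ℝ} {r : ℤ} (hs : s ≠ 0)
    (hconstr : ∀ x : ℝ → ℝ, IsClassDSolution ν a s x →
      x (2 * π) = x 0 + 2 * π * (r : ℝ)) : ∃ m : ℤ, a = m := by
  have hlift : ∀ x₀ : ℝ, ∃ p q : ℝ → ℂ, IsLinearizedSolution ν a s p q ∧ p 0 = 1 ∧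
      q 0 = Complex.exp (x₀ * I) ∧ q (2 * π) = p (2 * π) * q 0 := fun x₀ ↦ by
    obtain ⟨x, hx, h0⟩ := IsClassDSolution.exists_initial ν a s x₀
    obtain ⟨p, hp0, hp⟩ := hx.exists_linearized
    refine ⟨p, _, hp, hp0, by simp [hp0, h0], ?_⟩
    have hexp : Complex.exp (x (2 * π) * I) = Complex.exp (x 0 * I) :=
      Complex.exp_eq_exp_iff_exists_int.2 ⟨r, by rw [hconstr x hx]; push_cast; ring⟩
    simp only [hexp, hp0]
    ring
  have hexp_ne : ∀ y z : ℝ, |y - z| < 2 * π → y ≠ z →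
      Complex.exp (y * I) ≠ Complex.exp (z * I) := fun y z hlt hne h ↦ by
    obtain ⟨n, hn⟩ := Complex.exp_eq_exp_iff_exists_int.1 h
    have hn' : y - z = n * (2 * π) := by
      have : ((y - z : ℝ) : ℂ) * I = ((n * (2 * π) : ℝ) : ℂ) * I := by
        push_cast; linear_combination hn
      exact_mod_cast mul_right_cancel₀ Complex.I_ne_zero this
    rw [hn', abs_mul, abs_of_pos two_pi_pos] at hlt
    have hn1 : |(n : ℝ)| < 1 := by
      by_contra! hge
      nlinarith [two_pi_pos]
    have hn0 : n = 0 := Int.abs_lt_one_iff.1 (by exact_mod_cast hn1)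
    exact hne (by simpa [hn0, sub_eq_zero] using hn')
  obtain ⟨p₁, q₁, h₁, hp₁, hq₁, hm₁⟩ := hlift 0
  obtain ⟨p₂, q₂, h₂, hp₂, hq₂, hm₂⟩ := hlift 1
  obtain ⟨p₃, q₃, h₃, hp₃, hq₃, hm₃⟩ := hlift 2
  have hπ := pi_gt_three
  have hw₁₂ : q₂ 0 - q₁ 0 ≠ 0 := by
    rw [hq₁, hq₂]
    exact sub_ne_zero.2 (hexp_ne 1 0 (by norm_num; linarith) (by norm_num))
  have hw₁₃ : q₃ 0 - q₁ 0 ≠ 0 := by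
    rw [hq₁, hq₃]
    exact sub_ne_zero.2 (hexp_ne 2 0 (by norm_num; linarith) (by norm_num))
  have hw₂₃ : q₃ 0 - q₂ 0 ≠ 0 := by
    rw [hq₂, hq₃]
    exact sub_ne_zero.2 (hexp_ne 2 1 (by norm_num; linarith) (by norm_num))
  set E := Complex.exp (2 * π * a * I) with hE
  have h12 : p₁ (2 * π) * p₂ (2 * π) = E := by
    have := h₁.wronskian_two_pi h₂
    rw [hm₁, hm₂, hp₁, hp₂] at this
    exact mul_right_cancel₀ hw₁₂ (by linear_combination this)
  have h13 : p₁ (2 * π) * p₃ (2 * π) = E := by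
    have := h₁.wronskian_two_pi h₃
    rw [hm₁, hm₃, hp₁, hp₃] at this
    exact mul_right_cancel₀ hw₁₃ (by linear_combination this)
  have h23 : p₂ (2 * π) * p₃ (2 * π) = E := by
    have := h₂.wronskian_two_pi h₃
    rw [hm₂, hm₃, hp₂, hp₃] at this
    exact mul_right_cancel₀ hw₂₃ (by linear_combination this)
  have hE0 : E ≠ 0 := Complex.exp_ne_zero _
  have hp₃0 : p₃ (2 * π) ≠ 0 := right_ne_zero_of_mul (h13.trans_ne hE0)
  have heq : p₁ (2 * π) = p₂ (2 * π) := mul_right_cancel₀ hp₃0 (h13.trans h23.symm)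
  have hnorm : ‖p₁ (2 * π)‖ = 1 := by
    have hEn : ‖E‖ = 1 := by
      rw [hE, show (2 * π * a * I : ℂ) = ((2 * π * a : ℝ) : ℂ) * I by push_cast; ring,
        Complex.norm_exp_ofReal_mul_I]
    have : ‖p₁ (2 * π)‖ ^ 2 = 1 := by rw [← hEn, ← h12, ← heq, norm_mul, sq]
    exact (pow_eq_one_iff_of_nonneg (norm_nonneg _) two_ne_zero).1 this
  set b : ℝ := Complex.arg (p₁ (2 * π)) / (2 * π) with hbdef
  have hb : p₁ (2 * π) = Complex.exp (2 * π * b * I) := by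
    rw [hbdef]
    push_cast
    rw [mul_div_cancel₀ _ (by exact_mod_cast two_pi_pos.ne')]
    simpa [hnorm] using (Complex.norm_mul_exp_arg_mul_I (p₁ (2 * π))).symm
  have hbZ : ∃ n : ℤ, (b : ℂ) + n = 0 := by
    by_contra! hne
    have := IsLinearizedSolution.wronskian_eq_zero hs hne h₁ h₂ (by rw [← hb, hp₁, mul_one])
      (by rw [← hb, hm₁]) (by rw [← hb, hp₂, mul_one, heq]) (by rw [← hb, hm₂, heq])
    rw [hp₁, hp₂, one_mul, one_mul] at this
    exact hw₁₂ this
  obtain ⟨n, hn⟩ := hbZ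
  have hp1 : p₁ (2 * π) = 1 := by
    rw [hb]
    exact Complex.exp_eq_one_iff.2 ⟨-n, by push_cast; linear_combination (2 * π * I) * hn⟩
  have hE1 : E = 1 := by rw [← h12, ← heq, hp1, one_mul]
  obtain ⟨m, hm⟩ := Complex.exp_eq_one_iff.1 hE1
  refine ⟨m, ?_⟩
  have h2πI : (2 * π * I : ℂ) ≠ 0 := Complex.two_pi_I_ne_zero
  have : (a : ℂ) = m := mul_right_cancel₀ h2πI (by linear_combination hm)
  exact_mod_cast this

/-- If `0 < |ν| ≤ 1`, `s ≠ 0` and `(a, s)` is a constriction with rotation number `r`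
(every solution satisfies `x(2π) = x(0) + 2πr`), then `a = r`. -/
theorem constriction_abscissa_eq_rotation_number
    (ν a s : ℝ) (r : ℤ) (hν0 : 0 < |ν|) (hν1 : |ν| ≤ 1) (hs : s ≠ 0)
    (hconstr : ∀ x : ℝ → ℝ, IsClassDSolution ν a s x →
      x (2 * π) = x 0 + 2 * π * (r : ℝ)) :
    a = (r : ℝ) := by
  obtain ⟨m, rfl⟩ := exists_int_eq_of_constriction hs hconstr
  obtain ⟨x, hx, hx0⟩ := IsClassDSolution.exists_initial ν m s 0
  have hxc : Continuous x := continuous_iff_continuousAt.2 fun t ↦ (hx t).continuousAt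
  have hsinc : Continuous fun t ↦ Real.sin (x t) := by fun_prop
  have hFTC := intervalIntegral.integral_eq_sub_of_hasDerivAt (a := 0) (b := 2 * π)
    (fun t _ ↦ hx t) (Continuous.intervalIntegrable (by fun_prop) _ _)
  rw [intervalIntegral.integral_add (Continuous.intervalIntegrable (by fun_prop) _ _)
    (Continuous.intervalIntegrable (by fun_prop) _ _),
    intervalIntegral.integral_add (Continuous.intervalIntegrable (by fun_prop) _ _)
    (Continuous.intervalIntegrable (by fun_prop) _ _), intervalIntegral.integral_const_mul,
    intervalIntegral.integral_const_mul, integral_sin, hconstr x hx] at hFTC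
  simp only [intervalIntegral.integral_const, Real.cos_zero, Real.cos_two_pi, sub_self, mul_zero,
    smul_eq_mul, sub_zero, add_zero, add_sub_cancel_left] at hFTC
  set J := ∫ t in (0 : ℝ)..2 * π, Real.sin (x t) with hJ
  have hupper : J < 2 * π := by
    have := intervalIntegral.integral_lt_integral_of_continuousOn_of_le_of_exists_lt two_pi_pos
      hsinc.continuousOn (continuousOn_const (c := (1 : ℝ))) (fun t _ ↦ Real.sin_le_one _)
      ⟨0, ⟨le_rfl, two_pi_pos.le⟩, by simp [hx0]⟩
    simpa [hJ] using this
  have hlower : -(2 * π) < J := by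
    have := intervalIntegral.integral_lt_integral_of_continuousOn_of_le_of_exists_lt two_pi_pos
      (continuousOn_const (c := (-1 : ℝ))) hsinc.continuousOn (fun t _ ↦ Real.neg_one_le_sin _)
      ⟨0, ⟨le_rfl, two_pi_pos.le⟩, by simp [hx0]⟩
    simpa [hJ] using this
  have hνJ : |ν * J| < 2 * π := by
    rw [abs_mul]
    exact (mul_le_of_le_one_left (abs_nonneg J) hν1).trans_lt (abs_lt.2 ⟨hlower, hupper⟩)
  have hdiff : ν * J = ((r - m : ℤ) : ℝ) * (2 * π) := by push_cast; linarith
  rw [hdiff, abs_mul, abs_of_pos two_pi_pos] at hνJ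
  have hlt : |((r - m : ℤ) : ℝ)| < 1 := by
    by_contra! hge
    nlinarith [two_pi_pos]
  have hrm : r - m = 0 := Int.abs_lt_one_iff.1 (by exact_mod_cast hlt)
  exact_mod_cast (sub_eq_zero.1 hrm).symm
end

section
/- Let ν, a, s ∈ ℝ with ν ≠ 0 and s ≠ 0, and let r ∈ ℤ. Suppose that every solution x of the class-D equation with parameters (ν, a, s) satisfies x(2π) = x(0) + 2πr. Then a is an integer: there exists k ∈ ℤ with a = k. -/
open Real

open Set Filter Topology intervalIntegral
open scoped NNReal

/-- Global existence for a bounded, globally Lipschitz time-dependent vector field. -/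
theorem exists_global_solution_of_bounded_lipschitz {E : Type*} [NormedAddCommGroup E]
    [NormedSpace ℝ E] [CompleteSpace E] {f : ℝ → E → E} {K L : ℝ≥0}
    (hlip : ∀ t, LipschitzWith K (f t)) (hcont : ∀ x, Continuous (f · x))
    (hbound : ∀ t x, ‖f t x‖ ≤ L) (x₀ : E) :
    ∃ γ : ℝ → E, γ 0 = x₀ ∧ ∀ t, HasDerivAt γ (f t (γ t)) t := by
  have hloc (T : ℝ) (hT : 0 < T) :
      ∃ γ : ℝ → E, γ 0 = x₀ ∧ ∀ t ∈ Ioo (-T) T, HasDerivAt γ (f t (γ t)) t := by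
    have hmem : (0 : ℝ) ∈ Icc (-T) T := ⟨by linarith, hT.le⟩
    have hpl : IsPicardLindelof f (tmin := -T) (tmax := T) ⟨0, hmem⟩ x₀
        (L * T.toNNReal) 0 L K :=
      { lipschitzOnWith := fun t _ ↦ (hlip t).lipschitzOnWith
        continuousOn := fun x _ ↦ (hcont x).continuousOn
        norm_le := fun t _ x _ ↦ hbound t x
        mul_max_le := by simp [hT.le] }
    obtain ⟨γ, h0, hγ⟩ := hpl.exists_eq_forall_mem_Icc_hasDerivWithinAt₀
    exact ⟨γ, h0, fun t ht ↦
      (hγ t (Ioo_subset_Icc_self ht)).hasDerivAt (Icc_mem_nhds ht.1 ht.2)⟩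
  choose γ hγ0 hγ using fun t : ℝ ↦ hloc (|t| + 1) (by positivity)
  have hagree {t t' : ℝ} (h : |t| < |t'| + 1) : γ t t = γ t' t := by
    set m := min (|t| + 1) (|t'| + 1)
    have hm : |t| < m := lt_min (by linarith) h
    have hm0 : 0 < m := (abs_nonneg t).trans_lt hm
    refine ODE_solution_unique_of_mem_Ioo (v := f) (K := K) (s := fun _ ↦ univ) (a := -m) (b := m)
      (t₀ := 0) (fun t _ ↦ (hlip t).lipschitzOnWith) ⟨by linarith, hm0⟩
      (fun τ hτ ↦ ⟨hγ t τ ?_, mem_univ _⟩) (fun τ hτ ↦ ⟨hγ t' τ ?_, mem_univ _⟩)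
      (by rw [hγ0, hγ0]) (abs_lt.mp hm)
    · exact abs_lt.mp ((abs_lt.mpr hτ).trans_le (min_le_left _ _))
    · exact abs_lt.mp ((abs_lt.mpr hτ).trans_le (min_le_right _ _))
  refine ⟨fun t ↦ γ t t, hγ0 0, fun t ↦ ?_⟩
  refine (hγ t t (abs_lt.mp (by linarith))).congr_of_eventuallyEq ?_
  filter_upwards [continuous_abs.continuousAt.eventually_lt_const (by linarith : |t| < |t| + 1)]
    with τ hτ using hagree hτ

theorem exists_isClassDSolution (ν a s x₀ : ℝ) :
    ∃ x, IsClassDSolution ν a s x ∧ x 0 = x₀ := by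
  have hlip (t : ℝ) : LipschitzWith ‖ν‖₊ (fun x ↦ ν * sin x + a + s * sin t) := by
    refine LipschitzWith.of_dist_le_mul fun x y ↦ ?_
    have h : dist (sin x) (sin y) ≤ dist x y := by
      simpa using Real.lipschitzWith_sin.dist_le_mul x y
    rw [Real.dist_eq] at h ⊢
    rw [show ν * sin x + a + s * sin t - (ν * sin y + a + s * sin t) = ν * (sin x - sin y) by ring,
      abs_mul]
    exact mul_le_mul_of_nonneg_left h (abs_nonneg ν)
  have hbound (t x : ℝ) :
      ‖ν * sin x + a + s * sin t‖ ≤ (‖ν‖₊ + ‖a‖₊ + ‖s‖₊ : ℝ≥0) := by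
    have h (c y : ℝ) : ‖c * sin y‖ ≤ ‖c‖ := by
      rw [norm_mul]
      exact mul_le_of_le_one_right (norm_nonneg c) (abs_sin_le_one y)
    push_cast
    exact (norm_add₃_le).trans (by gcongr <;> apply h)
  obtain ⟨x, h0, hx⟩ := exists_global_solution_of_bounded_lipschitz hlip
    (fun x ↦ by fun_prop) hbound x₀
  exact ⟨x, hx, h0⟩

/-- The linear system whose projectivization `u / v` is the Riccati equation satisfied by
`exp (i x)`, for `x` a solution of the class-D equation. -/
structure IsLinearizedSolution_s1 (ν a s : ℝ) (u v : ℝ → ℂ) : Prop where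
  hasDerivAt_fst : ∀ t : ℝ,
    HasDerivAt u (Complex.I * (a + s * sin t) * u t - ν / 2 * v t) t
  hasDerivAt_snd : ∀ t : ℝ, HasDerivAt v (-(ν / 2) * u t) t

namespace IsLinearizedSolution_s1

variable {ν a s : ℝ} {u v u₁ v₁ u₂ v₂ : ℝ → ℂ}

theorem continuous_fst_s1 (h : IsLinearizedSolution_s1 ν a s u v) : Continuous u :=
  continuous_iff_continuousAt.mpr fun t ↦ (h.hasDerivAt_fst t).continuousAt

theorem continuous_snd_s1 (h : IsLinearizedSolution_s1 ν a s u v) : Continuous v :=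
  continuous_iff_continuousAt.mpr fun t ↦ (h.hasDerivAt_snd t).continuousAt

/-- Liouville's formula. -/
theorem wronskian_eq (h₁ : IsLinearizedSolution_s1 ν a s u₁ v₁)
    (h₂ : IsLinearizedSolution_s1 ν a s u₂ v₂) (t : ℝ) :
    u₁ t * v₂ t - u₂ t * v₁ t =
      (u₁ 0 * v₂ 0 - u₂ 0 * v₁ 0) * Complex.exp (Complex.I * (a * t + s * (1 - cos t))) := by
  have hexp (t : ℝ) : HasDerivAt
      (fun t : ℝ ↦ Complex.exp (-(Complex.I * (a * t + s * (1 - cos t)))))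
      (Complex.exp (-(Complex.I * (a * t + s * (1 - cos t)))) *
        -(Complex.I * (a + s * sin t))) t := by
    have hid : HasDerivAt (fun t : ℝ ↦ (t : ℂ)) 1 t := Complex.ofRealCLM.hasDerivAt
    have hcos : HasDerivAt (fun t : ℝ ↦ ((cos t : ℝ) : ℂ)) ((-sin t : ℝ) : ℂ) t :=
      (hasDerivAt_cos t).ofReal_comp
    convert! (((hid.const_mul (a : ℂ)).add
      ((hcos.const_sub 1).const_mul (s : ℂ))).const_mul Complex.I).neg.cexp using 1
    simp only [Pi.neg_apply, Pi.add_apply]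
    push_cast
    ring
  have hconst := is_const_of_deriv_eq_zero
    (f := fun t ↦ (u₁ t * v₂ t - u₂ t * v₁ t) *
      Complex.exp (-(Complex.I * (a * t + s * (1 - cos t)))))
  have hd (t : ℝ) := ((((h₁.hasDerivAt_fst t).mul (h₂.hasDerivAt_snd t)).sub
    ((h₂.hasDerivAt_fst t).mul (h₁.hasDerivAt_snd t))).mul (hexp t))
  have key := hconst (fun t ↦ (hd t).differentiableAt)
    (fun t ↦ (hd t).deriv.trans (by simp only [Pi.mul_apply, Pi.sub_apply]; ring)) t 0
  simp only [Complex.ofReal_zero, mul_zero, cos_zero, Complex.ofReal_one, sub_self, add_zero,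
    neg_zero, Complex.exp_zero, mul_one] at key
  rw [← key, mul_assoc, ← Complex.exp_add, neg_add_cancel, Complex.exp_zero, mul_one]

end IsLinearizedSolution_s1

theorem IsClassDSolution.exists_isLinearizedSolution {ν a s : ℝ} {x : ℝ → ℝ}
    (hx : IsClassDSolution ν a s x) :
    ∃ u v : ℝ → ℂ, IsLinearizedSolution_s1 ν a s u v ∧ (∀ t, v t ≠ 0) ∧
      ∀ t, u t = Complex.exp (Complex.I * x t) * v t := by
  have hxc : Continuous x := continuous_iff_continuousAt.mpr fun t ↦ (hx t).continuousAt
  set Φ : ℝ → ℂ := fun t ↦ Complex.exp (Complex.I * x t) with hΦ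
  have hΦc : Continuous Φ := by fun_prop
  set v : ℝ → ℂ := fun t ↦ Complex.exp (-(ν / 2) * ∫ τ in (0 : ℝ)..t, Φ τ) with hv
  have hv' (t : ℝ) : HasDerivAt v (-(ν / 2) * (Φ t * v t)) t := by
    convert! ((hΦc.integral_hasStrictDerivAt 0 t).hasDerivAt.const_mul (-(ν / 2 : ℂ))).cexp using 1
    simp only [hv]
    ring
  have hΦ' (t : ℝ) : HasDerivAt Φ
      (Complex.I * (a + s * sin t) * Φ t + ν / 2 * (Φ t ^ 2 - 1)) t := by
    convert! ((hx t).ofReal_comp.const_mul Complex.I).cexp using 1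
    have hsin : (2 : ℂ) * Complex.I * Complex.sin (x t) * Φ t = Φ t ^ 2 - 1 := by
      have hinv : Complex.exp (-(x t) * Complex.I) * Φ t = 1 := by
        rw [hΦ, ← Complex.exp_add]
        simp [mul_comm]
      have hΦt : Complex.exp (x t * Complex.I) = Φ t := by rw [hΦ, mul_comm]
      rw [Complex.sin, hΦt]
      linear_combination (Φ t ^ 2 - Complex.exp (-(x t) * Complex.I) * Φ t) * (-Complex.I_sq)
        - hinv
    push_cast
    rw [← hsin]
    ring
  refine ⟨fun t ↦ Φ t * v t, v, ⟨fun t ↦ ?_, hv'⟩, fun t ↦ Complex.exp_ne_zero _, fun t ↦ rfl⟩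
  convert! (hΦ' t).mul (hv' t) using 1
  ring

/-- The Fourier coefficient on `[0, 2π]` of the function `exp (-i b t) f t`. -/
noncomputable def twistedFourierCoeff (b : ℂ) (f : ℝ → ℂ) (n : ℤ) : ℂ :=
  ∫ t in (0 : ℝ)..2 * π, Complex.exp (-(Complex.I * (b + n) * t)) * f t

section TwistedFourierCoeff

variable {b : ℂ} {f g : ℝ → ℂ}

theorem twistedFourierCoeff_eq_fourierCoeffOn (b : ℂ) (f : ℝ → ℂ) (n : ℤ) :
    twistedFourierCoeff b f n = 2 * π *
      fourierCoeffOn two_pi_pos (fun t ↦ Complex.exp (-(Complex.I * b * t)) * f t) n := by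
  have hpi : (π : ℂ) ≠ 0 := Complex.ofReal_ne_zero.mpr pi_ne_zero
  rw [fourierCoeffOn_eq_integral, twistedFourierCoeff, Complex.real_smul, ← mul_assoc,
    show (2 * π * ((1 / (2 * π - 0) : ℝ) : ℂ)) = 1 by push_cast; field_simp; simp, one_mul]
  refine integral_congr fun t _ ↦ ?_
  simp only [fourier_coe_apply, smul_eq_mul]
  rw [← mul_assoc, ← Complex.exp_add]
  congr 2
  push_cast
  field_simp
  ring

theorem hasSum_sq_twistedFourierCoeff (b : ℂ) (hf : Continuous f) :
    HasSum (fun n ↦ ‖fourierCoeffOn two_pi_pos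
        (fun t ↦ Complex.exp (-(Complex.I * b * t)) * f t) n‖ ^ 2)
      ((2 * π - 0)⁻¹ • ∫ t in (0 : ℝ)..2 * π, ‖Complex.exp (-(Complex.I * b * t)) * f t‖ ^ 2) := by
  refine hasSum_sq_fourierCoeffOn two_pi_pos ?_
  have hc : Continuous fun t : ℝ ↦ Complex.exp (-(Complex.I * b * t)) * f t := by fun_prop
  obtain ⟨C, hC⟩ := (isCompact_Icc (a := (0 : ℝ)) (b := 2 * π)).exists_bound_of_continuousOn
    hc.continuousOn
  refine MeasureTheory.MemLp.of_bound hc.aestronglyMeasurable C ?_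
  filter_upwards [MeasureTheory.ae_restrict_mem measurableSet_Ioc] with t ht
    using hC t (Ioc_subset_Icc_self ht)

theorem tendsto_twistedFourierCoeff (b : ℂ) (hf : Continuous f) :
    Tendsto (twistedFourierCoeff b f) cofinite (𝓝 0) := by
  have h := (hasSum_sq_twistedFourierCoeff b hf).summable.tendsto_cofinite_zero
  have h' := h.sqrt
  simp only [sqrt_sq (norm_nonneg _), sqrt_zero] at h'
  have h'' := (tendsto_zero_iff_norm_tendsto_zero.mpr h').const_mul (2 * π : ℂ)
  simpa only [← twistedFourierCoeff_eq_fourierCoeffOn, mul_zero] using h''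

theorem eq_zero_of_twistedFourierCoeff_eq_zero (hf : Continuous f)
    (h : ∀ n, twistedFourierCoeff b f n = 0) {t : ℝ} (ht : t ∈ Icc 0 (2 * π)) : f t = 0 := by
  have hpi : (π : ℂ) ≠ 0 := Complex.ofReal_ne_zero.mpr pi_ne_zero
  have hsum := hasSum_sq_twistedFourierCoeff b hf
  have hzero (n : ℤ) : fourierCoeffOn two_pi_pos
      (fun t ↦ Complex.exp (-(Complex.I * b * t)) * f t) n = 0 := by
    simpa [twistedFourierCoeff_eq_fourierCoeffOn, hpi] using h n
  simp only [hzero, norm_zero, ne_eq, OfNat.ofNat_ne_zero, not_false_eq_true, zero_pow] at hsum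
  have hint := hsum.unique hasSum_zero
  have hint0 : ∫ t in (0 : ℝ)..2 * π, ‖Complex.exp (-(Complex.I * b * t)) * f t‖ ^ 2 = 0 := by
    simpa [pi_ne_zero] using hint
  have hc : Continuous fun t : ℝ ↦ ‖Complex.exp (-(Complex.I * b * t)) * f t‖ ^ 2 := by fun_prop
  by_contra hft
  refine (integral_pos two_pi_pos hc.continuousOn (fun _ _ ↦ by positivity)
    ⟨t, ht, ?_⟩).ne' hint0
  exact pow_pos (norm_pos_iff.mpr (mul_ne_zero (Complex.exp_ne_zero _) hft)) 2

theorem twistedFourierCoeff_add (hf : Continuous f) (hg : Continuous g) (n : ℤ) :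
    twistedFourierCoeff b (fun t ↦ f t + g t) n =
      twistedFourierCoeff b f n + twistedFourierCoeff b g n := by
  simp only [twistedFourierCoeff, mul_add]
  exact integral_add (Continuous.intervalIntegrable (by fun_prop) _ _)
    (Continuous.intervalIntegrable (by fun_prop) _ _)

theorem twistedFourierCoeff_const_mul (c : ℂ) (n : ℤ) :
    twistedFourierCoeff b (fun t ↦ c * f t) n = c * twistedFourierCoeff b f n := by
  simp only [twistedFourierCoeff, mul_left_comm _ c, integral_const_mul]

theorem twistedFourierCoeff_sin_mul (hf : Continuous f) (n : ℤ) :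
    2 * Complex.I * twistedFourierCoeff b (fun t ↦ (sin t : ℂ) * f t) n =
      twistedFourierCoeff b f (n - 1) - twistedFourierCoeff b f (n + 1) := by
  simp only [twistedFourierCoeff]
  rw [← integral_const_mul, ← integral_sub (Continuous.intervalIntegrable (by fun_prop) _ _)
    (Continuous.intervalIntegrable (by fun_prop) _ _)]
  refine integral_congr fun t _ ↦ ?_
  have hsub : Complex.exp (-(Complex.I * (b + (n - 1 : ℤ)) * t)) =
      Complex.exp (-(Complex.I * (b + n) * t)) * Complex.exp (t * Complex.I) := by
    rw [← Complex.exp_add]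
    push_cast
    ring_nf
  have hadd : Complex.exp (-(Complex.I * (b + (n + 1 : ℤ)) * t)) =
      Complex.exp (-(Complex.I * (b + n) * t)) * Complex.exp (-t * Complex.I) := by
    rw [← Complex.exp_add]
    push_cast
    ring_nf
  simp only [hsub, hadd, Complex.ofReal_sin, Complex.sin]
  linear_combination (Complex.exp (-(Complex.I * (b + n) * t)) * f t *
    (Complex.exp (-t * Complex.I) - Complex.exp (t * Complex.I))) * Complex.I_sq

theorem twistedFourierCoeff_deriv (hfg : ∀ t, HasDerivAt f (g t) t) (hg : Continuous g)
    (hper : f (2 * π) = Complex.exp (2 * π * Complex.I * b) * f 0) (n : ℤ) :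
    twistedFourierCoeff b g n = Complex.I * (b + n) * twistedFourierCoeff b f n := by
  have hf : Continuous f := continuous_iff_continuousAt.mpr fun t ↦ (hfg t).continuousAt
  have hexp (t : ℝ) : HasDerivAt (fun t : ℝ ↦ Complex.exp (-(Complex.I * (b + n) * t)))
      (-(Complex.I * (b + n)) * Complex.exp (-(Complex.I * (b + n) * t))) t := by
    have hid : HasDerivAt (fun t : ℝ ↦ (t : ℂ)) 1 t := Complex.ofRealCLM.hasDerivAt
    convert! (hid.const_mul (Complex.I * (b + n))).neg.cexp using 1
    simp only [Pi.neg_apply]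
    ring
  have hparts := integral_mul_deriv_eq_deriv_mul (a := 0) (b := 2 * π)
    (fun t _ ↦ hexp t) (fun t _ ↦ hfg t)
    (Continuous.intervalIntegrable (by fun_prop) _ _) (hg.intervalIntegrable _ _)
  have hboundary : Complex.exp (-(Complex.I * (b + n) * (2 * π : ℝ))) *
      Complex.exp (2 * π * Complex.I * b) = 1 := by
    rw [← Complex.exp_add, Complex.exp_eq_one_iff]
    exact ⟨-n, by push_cast; ring⟩
  simp only [twistedFourierCoeff]
  rw [hparts, hper, ← mul_assoc, hboundary]
  simp only [mul_assoc _ _ (f _), integral_const_mul]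
  simp

end TwistedFourierCoeff

/-- Two solutions tending to zero at infinity of the recurrence
`w (n + 1) = w (n - 1) + B n * w n` are proportional: their Casoratian has constant norm. -/
theorem exists_linear_relation_of_recurrence {B w p : ℤ → ℂ}
    (hw : ∀ n, w (n + 1) = w (n - 1) + B n * w n) (hp : ∀ n, p (n + 1) = p (n - 1) + B n * p n)
    (hw0 : Tendsto w cofinite (𝓝 0)) (hp0 : Tendsto p cofinite (𝓝 0)) :
    ∃ α β : ℂ, (α ≠ 0 ∨ β ≠ 0) ∧ ∀ n, α * w n + β * p n = 0 := by
  have hcas : w 0 * p 1 - p 0 * w 1 = 0 := by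
    have hstep (n : ℕ) : ‖w n * p (n + 1) - p n * w (n + 1)‖ = ‖w 0 * p 1 - p 0 * w 1‖ := by
      induction n with
      | zero => simp
      | succ n ih =>
        rw [← ih, ← norm_neg]
        congr 1
        have h₁ := hw (n + 1)
        have h₂ := hp (n + 1)
        rw [add_sub_cancel_right] at h₁ h₂
        push_cast
        rw [h₁, h₂]
        ring
    have hcast : Tendsto (fun n : ℕ ↦ (n : ℤ)) atTop cofinite := by
      rw [← Nat.cofinite_eq_atTop]
      exact Nat.cast_injective.tendsto_cofinite
    have hcast' : Tendsto (fun n : ℕ ↦ (n : ℤ) + 1) atTop cofinite :=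
      (add_left_injective (1 : ℤ)).tendsto_cofinite.comp hcast
    have hlim := (((hw0.comp hcast).mul (hp0.comp hcast')).sub
      ((hp0.comp hcast).mul (hw0.comp hcast'))).norm
    simp only [Function.comp_apply, hstep, mul_zero, sub_zero, norm_zero] at hlim
    exact norm_eq_zero.mp (tendsto_nhds_unique tendsto_const_nhds hlim)
  obtain ⟨α, β, hαβ, h0, h1⟩ : ∃ α β : ℂ, (α ≠ 0 ∨ β ≠ 0) ∧
      α * w 0 + β * p 0 = 0 ∧ α * w 1 + β * p 1 = 0 := by
    by_cases hz : w 0 = 0 ∧ p 0 = 0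
    · by_cases hz' : w 1 = 0 ∧ p 1 = 0
      · exact ⟨1, 0, by simp, by simp [hz], by simp [hz']⟩
      · exact ⟨p 1, -w 1, by grind, by simp [hz], by ring⟩
    · exact ⟨p 0, -w 0, by grind, by ring, by linear_combination -hcas⟩
  refine ⟨α, β, hαβ, ?_⟩
  have hboth (n : ℤ) : α * w n + β * p n = 0 ∧ α * w (n + 1) + β * p (n + 1) = 0 := by
    induction n using Int.induction_on with
    | zero => exact ⟨h0, by simpa using h1⟩
    | succ n ih =>
      refine ⟨ih.2, ?_⟩
      have h₁ := hw (n + 1)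
      have h₂ := hp (n + 1)
      rw [add_sub_cancel_right] at h₁ h₂
      rw [h₁, h₂]
      linear_combination ih.1 + B (n + 1) * ih.2
    | pred n ih =>
      rw [sub_add_cancel]
      refine ⟨?_, ih.1⟩
      linear_combination ih.2 - B (-n) * ih.1 - α * hw (-n) - β * hp (-n)
  exact fun n ↦ (hboth n).1

theorem IsLinearizedSolution_s1.twistedFourierCoeff_recurrence {ν a s : ℝ} {u v : ℝ → ℂ} {b : ℂ}
    (h : IsLinearizedSolution_s1 ν a s u v) (hs : s ≠ 0) (hb : ∀ n : ℤ, b + n ≠ 0)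
    (hu : u (2 * π) = Complex.exp (2 * π * Complex.I * b) * u 0)
    (hv : v (2 * π) = Complex.exp (2 * π * Complex.I * b) * v 0) (n : ℤ) :
    twistedFourierCoeff b u (n + 1) = twistedFourierCoeff b u (n - 1) +
      2 / s * (Complex.I * (a - (b + n)) - Complex.I * ν ^ 2 / 4 / (b + n)) *
        twistedFourierCoeff b u n := by
  have huc := h.continuous_fst_s1
  have hvc := h.continuous_snd_s1
  have hs' : (s : ℂ) ≠ 0 := Complex.ofReal_ne_zero.mpr hs
  have hsnd := twistedFourierCoeff_deriv h.hasDerivAt_snd (by fun_prop) hv n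
  have hfst := twistedFourierCoeff_deriv h.hasDerivAt_fst (by fun_prop) hu n
  have hsin := twistedFourierCoeff_sin_mul (b := b) huc n
  have hexpand : (fun t : ℝ ↦ Complex.I * (a + s * sin t) * u t - ν / 2 * v t) =
      fun t ↦ (Complex.I * a) * u t + (((Complex.I * s) * ((sin t : ℂ) * u t)) +
        (-(ν / 2)) * v t) := by
    funext t
    ring
  rw [twistedFourierCoeff_const_mul] at hsnd
  rw [hexpand, twistedFourierCoeff_add (by fun_prop) (by fun_prop),
    twistedFourierCoeff_add (by fun_prop) (by fun_prop), twistedFourierCoeff_const_mul,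
    twistedFourierCoeff_const_mul, twistedFourierCoeff_const_mul] at hfst
  have hbn := hb n
  have hV : twistedFourierCoeff b v n =
      Complex.I * ν / 2 / (b + n) * twistedFourierCoeff b u n := by
    field_simp
    linear_combination (2 * Complex.I) * hsnd
      + (2 * (b + n) * twistedFourierCoeff b v n) * Complex.I_sq
  rw [hV] at hfst
  have hrec : s * (twistedFourierCoeff b u (n + 1) - twistedFourierCoeff b u (n - 1)) =
      2 * (Complex.I * (a - (b + n)) - Complex.I * ν ^ 2 / 4 / (b + n)) *
        twistedFourierCoeff b u n := by
    linear_combination s * hsin - 2 * hfst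
  field_simp at hrec ⊢
  linear_combination hrec

/-- If two independent solutions of the linearized system have the same multiplier over the period
`2π`, this multiplier is `1`. -/
theorem IsLinearizedSolution_s1.multiplier_eq_one {ν a s : ℝ} {u₁ v₁ u₂ v₂ : ℝ → ℂ} {c : ℂ}
    (h₁ : IsLinearizedSolution_s1 ν a s u₁ v₁) (h₂ : IsLinearizedSolution_s1 ν a s u₂ v₂)
    (hν : ν ≠ 0) (hs : s ≠ 0) (hc : c ≠ 0)
    (hu₁ : u₁ (2 * π) = c * u₁ 0) (hv₁ : v₁ (2 * π) = c * v₁ 0)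
    (hu₂ : u₂ (2 * π) = c * u₂ 0) (hv₂ : v₂ (2 * π) = c * v₂ 0)
    (hind : u₁ 0 * v₂ 0 - u₂ 0 * v₁ 0 ≠ 0) : c = 1 := by
  by_contra hc1
  obtain ⟨b, rfl⟩ : ∃ b : ℂ, Complex.exp (2 * π * Complex.I * b) = c := by
    refine ⟨Complex.log c / (2 * π * Complex.I), ?_⟩
    rw [mul_div_cancel₀ _ Complex.two_pi_I_ne_zero, Complex.exp_log hc]
  have hb (n : ℤ) : b + n ≠ 0 := fun h ↦ hc1 <| Complex.exp_eq_one_iff.mpr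
    ⟨-n, by rw [eq_neg_of_add_eq_zero_left h]; push_cast; ring⟩
  obtain ⟨α, β, hαβ, hrel⟩ := exists_linear_relation_of_recurrence
    (h₁.twistedFourierCoeff_recurrence hs hb hu₁ hv₁)
    (h₂.twistedFourierCoeff_recurrence hs hb hu₂ hv₂)
    (tendsto_twistedFourierCoeff b h₁.continuous_fst_s1)
    (tendsto_twistedFourierCoeff b h₂.continuous_fst_s1)
  have hu₁c := h₁.continuous_fst_s1
  have hu₂c := h₂.continuous_fst_s1
  have hzero {t : ℝ} (ht : t ∈ Icc 0 (2 * π)) : α * u₁ t + β * u₂ t = 0 := by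
    refine eq_zero_of_twistedFourierCoeff_eq_zero (b := b) (f := fun t ↦ α * u₁ t + β * u₂ t)
      (by fun_prop) (fun n ↦ ?_) ht
    rw [twistedFourierCoeff_add (by fun_prop) (by fun_prop), twistedFourierCoeff_const_mul,
      twistedFourierCoeff_const_mul, hrel]
  have hmem : π ∈ Icc 0 (2 * π) := ⟨pi_pos.le, by linarith [pi_pos]⟩
  have hu := hzero hmem
  have hderiv : α * (Complex.I * (a + s * sin π) * u₁ π - ν / 2 * v₁ π) +
      β * (Complex.I * (a + s * sin π) * u₂ π - ν / 2 * v₂ π) = 0 := by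
    refine (((h₁.hasDerivAt_fst π).const_mul α).add
      ((h₂.hasDerivAt_fst π).const_mul β)).unique
        ((hasDerivAt_const π (0 : ℂ)).congr_of_eventuallyEq ?_)
    filter_upwards [Icc_mem_nhds pi_pos (by linarith [pi_pos] : π < 2 * π)] with t ht
      using hzero ht
  have hν' : (ν : ℂ) ≠ 0 := Complex.ofReal_ne_zero.mpr hν
  have hv : α * v₁ π + β * v₂ π = 0 := by
    refine (mul_eq_zero.mp (?_ : (ν : ℂ) * (α * v₁ π + β * v₂ π) = 0)).resolve_left hν'
    linear_combination -2 * hderiv + 2 * Complex.I * (a + s * sin π) * hu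
  have hW : u₁ π * v₂ π - u₂ π * v₁ π ≠ 0 := by
    rw [h₁.wronskian_eq h₂]
    exact mul_ne_zero hind (Complex.exp_ne_zero _)
  rcases hαβ with h | h
  · refine hW ((mul_eq_zero.mp (?_ : α * _ = 0)).resolve_left h)
    linear_combination v₂ π * hu - u₂ π * hv
  · refine hW ((mul_eq_zero.mp (?_ : β * _ = 0)).resolve_left h)
    linear_combination u₁ π * hv - v₁ π * hu

/-- If `ν ≠ 0`, `s ≠ 0` and `(a, s)` is a constriction with rotation number `r`
(every solution satisfies `x(2π) = x(0) + 2πr`), then `a` is an integer. -/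
theorem constriction_abscissa_is_integer
    (ν a s : ℝ) (r : ℤ) (hν : ν ≠ 0) (hs : s ≠ 0)
    (hconstr : ∀ x : ℝ → ℝ, IsClassDSolution ν a s x →
      x (2 * π) = x 0 + 2 * π * (r : ℝ)) :
    ∃ k : ℤ, a = (k : ℝ) := by
  have hsol (x₀ : ℝ) : ∃ (u v : ℝ → ℂ) (c : ℂ), IsLinearizedSolution_s1 ν a s u v ∧ c ≠ 0 ∧
      v 0 ≠ 0 ∧ u 0 = Complex.exp (Complex.I * x₀) * v 0 ∧
      u (2 * π) = c * u 0 ∧ v (2 * π) = c * v 0 := by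
    obtain ⟨x, hx, rfl⟩ := exists_isClassDSolution ν a s x₀
    obtain ⟨u, v, huv, hv, hu⟩ := hx.exists_isLinearizedSolution
    have hv2 : v (2 * π) = v (2 * π) / v 0 * v 0 := (div_mul_cancel₀ _ (hv 0)).symm
    refine ⟨u, v, v (2 * π) / v 0, huv, div_ne_zero (hv _) (hv _), hv 0, hu 0, ?_, hv2⟩
    have hexp : Complex.exp (Complex.I * x (2 * π)) = Complex.exp (Complex.I * x 0) :=
      Complex.exp_eq_exp_iff_exists_int.mpr ⟨r, by rw [hconstr x hx]; push_cast; ring⟩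
    rw [hu, hu, hexp, mul_left_comm, ← hv2]
  obtain ⟨u₁, v₁, c₁, h₁, hc₁, hv₁, hi₁, hu₁', hv₁'⟩ := hsol 0
  obtain ⟨u₂, v₂, c₂, h₂, hc₂, hv₂, hi₂, hu₂', hv₂'⟩ := hsol π
  obtain ⟨u₃, v₃, c₃, h₃, hc₃, hv₃, hi₃, hu₃', hv₃'⟩ := hsol (π / 2)
  have hexp_pi : Complex.exp (Complex.I * π) = -1 := by rw [mul_comm, Complex.exp_pi_mul_I]
  have hexp_half : Complex.exp (Complex.I * (π / 2 : ℝ)) = Complex.I := by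
    rw [mul_comm]
    push_cast
    exact Complex.exp_pi_div_two_mul_I
  rw [hexp_pi] at hi₂
  rw [hexp_half] at hi₃
  simp only [Complex.ofReal_zero, mul_zero, Complex.exp_zero, one_mul] at hi₁
  set e := Complex.exp (Complex.I * (a * (2 * π : ℝ) + s * (1 - cos (2 * π)))) with he
  have hmul {u v u' v' : ℝ → ℂ} {c c' : ℂ} (h : IsLinearizedSolution_s1 ν a s u v)
      (h' : IsLinearizedSolution_s1 ν a s u' v') (hu : u (2 * π) = c * u 0) (hv : v (2 * π) = c * v 0)
      (hu' : u' (2 * π) = c' * u' 0) (hv' : v' (2 * π) = c' * v' 0)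
      (hW : u 0 * v' 0 - u' 0 * v 0 ≠ 0) : c * c' = e := by
    have := h.wronskian_eq h' (2 * π)
    rw [hu, hv, hu', hv'] at this
    exact mul_left_cancel₀ hW (by linear_combination this)
  have hW₁₂ : u₁ 0 * v₂ 0 - u₂ 0 * v₁ 0 ≠ 0 := by
    rw [hi₁, hi₂, show v₁ 0 * v₂ 0 - -1 * v₂ 0 * v₁ 0 = 2 * (v₁ 0 * v₂ 0) by ring]
    exact mul_ne_zero two_ne_zero (mul_ne_zero hv₁ hv₂)
  have hW₁₃ : u₁ 0 * v₃ 0 - u₃ 0 * v₁ 0 ≠ 0 := by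
    rw [hi₁, hi₃, show v₁ 0 * v₃ 0 - Complex.I * v₃ 0 * v₁ 0 =
      (1 - Complex.I) * (v₁ 0 * v₃ 0) by ring]
    exact mul_ne_zero (fun h ↦ by simpa using congrArg Complex.re h) (mul_ne_zero hv₁ hv₃)
  have hW₂₃ : u₂ 0 * v₃ 0 - u₃ 0 * v₂ 0 ≠ 0 := by
    rw [hi₂, hi₃, show -1 * v₂ 0 * v₃ 0 - Complex.I * v₃ 0 * v₂ 0 =
      (-1 - Complex.I) * (v₂ 0 * v₃ 0) by ring]
    exact mul_ne_zero (fun h ↦ by simpa using congrArg Complex.re h) (mul_ne_zero hv₂ hv₃)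
  have h₁₂ := hmul h₁ h₂ hu₁' hv₁' hu₂' hv₂' hW₁₂
  have h₁₃ := hmul h₁ h₃ hu₁' hv₁' hu₃' hv₃' hW₁₃
  have h₂₃ := hmul h₂ h₃ hu₂' hv₂' hu₃' hv₃' hW₂₃
  obtain rfl : c₁ = c₂ := mul_right_cancel₀ hc₃ (h₁₃.trans h₂₃.symm)
  obtain rfl := h₁.multiplier_eq_one h₂ hν hs hc₁ hu₁' hv₁' hu₂' hv₂' hW₁₂
  rw [mul_one, eq_comm, he, Complex.exp_eq_one_iff] at h₁₂
  obtain ⟨k, hk⟩ := h₁₂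
  refine ⟨k, Complex.ofReal_injective (mul_right_cancel₀ Complex.two_pi_I_ne_zero ?_)⟩
  rw [cos_two_pi] at hk
  push_cast at hk ⊢
  linear_combination hk
end
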